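/- For any finite non-degenerate network (V,K), any sleeping rate λ ∈ (0,∞) and any admissible insertion distribution ν, the relaxation time of the ARW(K,λ,ν) chain is exactly t_rel = (min_{x∈V} p(x))^{-1}, where p(x) = P_ν(τ_x < τ_†) is the probability that a (K,ν)-walk hits x before dying. -/

import Mathlib

open scoped ENNReal BigOperators
open Filter Asymptotics

namespace ARW

variable {V : Type} [Fintype V] [DecidableEq V]

/-- A sub-stochastic matrix: every row sums to at most `1`. -/
def SubStochastic (K : V → V → ℝ≥0∞) : Prop := ∀ x, ∑ y, K x y ≤ 1

/-- Non-degenerate: no principal sub-matrix of `K` is stochastic. -/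
def NonDegenerate (K : V → V → ℝ≥0∞) : Prop :=
  ∀ S : Finset V, S.Nonempty → ∃ x ∈ S, ∑ y ∈ S, K x y ≠ 1

/-- A probability vector on `V`. -/
def IsProbVec (ν : V → ℝ≥0∞) : Prop := ∑ x, ν x = 1

/-- Probability that the `K`-walk currently at `x` next follows the trajectory `xs`
and is then killed. -/
noncomputable def pathProb (K : V → V → ℝ≥0∞) : V → List V → ℝ≥0∞
  | x, [] => 1 - ∑ y, K x y
  | x, y :: ys => K x y * pathProb K y ys

/-- Probability that a `(K,ν)`-walk has the (finite) full trajectory `w`. -/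
noncomputable def walkProb (K : V → V → ℝ≥0∞) (ν : V → ℝ≥0∞) : List V → ℝ≥0∞
  | [] => 0
  | x :: xs => ν x * pathProb K x xs

/-- `p(x)`: the probability that a `(K,ν)`-walk visits `x` before dying. -/
noncomputable def hitProb (K : V → V → ℝ≥0∞) (ν : V → ℝ≥0∞) (x : V) : ℝ≥0∞ :=
  ∑' w : List V, if x ∈ w then walkProb K ν w else 0

/-- The insertion law `ν` is admissible when every site has a chance of being
visited by a `(K,ν)`-walk. -/
def Admissible (K : V → V → ℝ≥0∞) (ν : V → ℝ≥0∞) : Prop := ∀ x, 0 < hitProb K ν x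

/-- The uniform law on `V`. -/
noncomputable def unifLaw (V : Type) [Fintype V] : V → ℝ≥0∞ :=
  fun _ => (Fintype.card V : ℝ≥0∞)⁻¹

/-! ### IDLA -/

/-- The IDLA update: the walker settles at the first site of its trajectory
which is not already occupied. -/
def idlaUpdate (S : Finset V) : List V → Finset V
  | [] => S
  | x :: xs => if x ∈ S then idlaUpdate S xs else insert x S

/-- The IDLA aggregate obtained from the initial set `A` after using the walks `ws`. -/
def idlaSet (A : Finset V) (ws : List (List V)) : Finset V := ws.foldl idlaUpdate A

/-- `P(T^A > t)`: probability that the IDLA process started from `A` and driven by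
i.i.d. `(K,ν)`-walks has not filled `V` after `t` steps. -/
noncomputable def idlaTail (K : V → V → ℝ≥0∞) (ν : V → ℝ≥0∞) (A : Finset V) (t : ℕ) : ℝ≥0∞ :=
  ∑' ws : Fin t → List V,
    (∏ i, walkProb K ν (ws i)) * (if idlaSet A (List.ofFn ws) = Finset.univ then 0 else 1)

/-- `E[T^A]`: the expected filling time of IDLA started from `A`. -/
noncomputable def idlaMean (K : V → V → ℝ≥0∞) (ν : V → ℝ≥0∞) (A : Finset V) : ℝ≥0∞ :=
  ∑' t : ℕ, idlaTail K ν A t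

/-- `Var(T^A)`: the variance of the filling time of IDLA started from `A`. -/
noncomputable def idlaVar (K : V → V → ℝ≥0∞) (ν : V → ℝ≥0∞) (A : Finset V) : ℝ≥0∞ :=
  (∑' t : ℕ, (2 * t + 1) * idlaTail K ν A t) - (idlaMean K ν A) ^ 2

/-! ### The ARW chain -/

/-- The state of a single site: empty, one sleeping particle, or `n+1` active particles. -/
inductive Site : Type
  | empty : Site
  | sleeping : Site
  | active (n : ℕ) : Site
deriving DecidableEq

/-- A configuration of particles. -/
abbrev Conf (V : Type) := V → Site

def Site.isActive : Site → Bool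
  | .active _ => true
  | _ => false

/-- The set of sites holding at least one active particle. -/
def activeSites (η : Conf V) : Finset V := Finset.univ.filter fun x => (η x).isActive

/-- Adding one active particle to a site (waking a sleeping particle if present). -/
def Site.addActive : Site → Site
  | .empty => .active 0
  | .sleeping => .active 1
  | .active n => .active (n + 1)

/-- Removing one active particle from a site. -/
def Site.removeOne : Site → Site
  | .active (n + 1) => .active n
  | _ => .empty

/-- Adding one active particle at site `y`. -/
def addActiveAt (η : Conf V) (y : V) : Conf V := Function.update η y (η y).addActive

/-- One sequential toppling step of ARW stabilization with sleep rate `lam`: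
an active site `x` is selected (if any); if its particle is alone it falls asleep
with probability `lam/(1+lam)`, moves to `y` with probability `K x y/(1+lam)` and
dies with the remaining probability; if it is not alone it moves to `y` with
probability `K x y` and dies with the remaining probability.  Stable
configurations are absorbing. -/
noncomputable def toppleKernel (K : V → V → ℝ≥0∞) (lam : ℝ) (η ξ : Conf V) : ℝ≥0∞ :=
  if h : (activeSites η).Nonempty then
    let x := h.choose
    let ημ : Conf V := Function.update η x (η x).removeOne
    let move : ℝ≥0∞ := ∑ y, if ξ = addActiveAt ημ y then K x y else 0
    let die : ℝ≥0∞ := if ξ = ημ then 1 - ∑ y, K x y else 0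
    if η x = Site.active 0 then
      ((if ξ = Function.update η x Site.sleeping then ENNReal.ofReal lam else 0) + move + die)
        / (ENNReal.ofReal lam + 1)
    else move + die
  else if ξ = η then 1 else 0

/-- Iterates of a sub-probability kernel on configurations. -/
noncomputable def kernelPow (M : Conf V → Conf V → ℝ≥0∞) : ℕ → Conf V → Conf V → ℝ≥0∞
  | 0 => fun η ξ => if ξ = η then 1 else 0
  | t + 1 => fun η ξ => ∑' σ : Conf V, M η σ * kernelPow M t σ ξ

/-- A stable configuration, seen as a configuration (`true` = sleeping particle). -/
def embed (b : V → Bool) : Conf V := fun x => if b x then Site.sleeping else Site.empty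

/-- One step of the `ARW(K,lam,ν)` chain: insert an active particle at a `ν`-distributed
site and stabilize; `arwStep K lam ν η ξ` is the probability of reaching the stable
configuration `ξ` from the stable configuration `η`. -/
noncomputable def arwStep (K : V → V → ℝ≥0∞) (lam : ℝ) (ν : V → ℝ≥0∞)
    (η ξ : V → Bool) : ℝ≥0∞ :=
  ∑ x, ν x * ⨆ t, kernelPow (toppleKernel K lam) t (addActiveAt (embed η) x) (embed ξ)

/-- The transition matrix of the `ARW(K,lam,ν)` chain on stable configurations. -/
noncomputable def arwMatrix (K : V → V → ℝ≥0∞) (lam : ℝ) (ν : V → ℝ≥0∞) :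
    Matrix (V → Bool) (V → Bool) ℝ :=
  Matrix.of fun η ξ => (arwStep K lam ν η ξ).toReal

/-! ### Distances to equilibrium, mixing and relaxation times -/

variable {S : Type} [Fintype S] [DecidableEq S]

/-- `π` is a stationary probability distribution for `P`. -/
def IsStationary (P : Matrix S S ℝ) (π : S → ℝ) : Prop :=
  (∀ s, 0 ≤ π s) ∧ (∑ s, π s = 1) ∧ ∀ s, ∑ r, π r * P r s = π s

/-- The separation distance to equilibrium at time `t`. -/
noncomputable def sepDist (P : Matrix S S ℝ) (π : S → ℝ) (t : ℕ) : ℝ :=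
  ⨆ η, ⨆ ξ, (1 - (P ^ t) η ξ / π ξ)

/-- The separation mixing time with precision `ε`. -/
noncomputable def sepMix (P : Matrix S S ℝ) (π : S → ℝ) (ε : ℝ) : ℕ :=
  sInf {t : ℕ | sepDist P π t ≤ ε}

/-- The total-variation distance to equilibrium at time `t`. -/
noncomputable def tvDist (P : Matrix S S ℝ) (π : S → ℝ) (t : ℕ) : ℝ :=
  ⨆ η, ⨆ A : Finset S, |∑ ξ ∈ A, ((P ^ t) η ξ - π ξ)|

/-- The total-variation mixing time with precision `ε`. -/
noncomputable def tvMix (P : Matrix S S ℝ) (π : S → ℝ) (ε : ℝ) : ℕ :=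
  sInf {t : ℕ | tvDist P π t ≤ ε}

/-- The relaxation time `1/(1-ρ)`, where `ρ` is the largest modulus of the
(complex) eigenvalues of `P` other than `1`. -/
noncomputable def relTime (P : Matrix S S ℝ) : ℝ :=
  (1 - sSup {r : ℝ | ∃ z : ℂ,
      z ≠ 1 ∧ (P.map (fun a : ℝ => (a : ℂ))).charpoly.IsRoot z ∧ r = ‖z‖})⁻¹

/-- Separation (or total-variation) cutoff for a sequence of chains with distance
functions `d n` and mixing times `ts n`. -/
def HasCutoff (d : ℕ → ℕ → ℝ) (ts : ℕ → ℕ) : Prop :=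
  ∀ α : ℝ, 0 ≤ α →
    (α < 1 → Tendsto (fun n => d n ⌊α * (ts n : ℝ)⌋₊) atTop (nhds 1)) ∧
    (1 < α → Tendsto (fun n => d n ⌊α * (ts n : ℝ)⌋₊) atTop (nhds 0))

end ARW
namespace ARW

section
set_option linter.unusedSectionVars false
variable {V : Type} [Fintype V] [DecidableEq V]

/-- action of an instruction at `x`: `none` = sleep, `some none` = die, `some (some y)` = jump. -/
def act (x : V) : Option (Option V) → Conf V → Conf V
  | none, η => if η x = Site.active 0 then Function.update η x Site.sleeping else η
  | some none, η => Function.update η x (η x).removeOne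
  | some (some y), η => addActiveAt (Function.update η x (η x).removeOne) y

noncomputable def wt (K : V → V → ℝ≥0∞) (lam : ℝ) (x : V) : Option (Option V) → ℝ≥0∞
  | none => ENNReal.ofReal lam / (ENNReal.ofReal lam + 1)
  | some none => (1 - ∑ y, K x y) / (ENNReal.ofReal lam + 1)
  | some (some y) => K x y / (ENNReal.ofReal lam + 1)

noncomputable def top (K : V → V → ℝ≥0∞) (lam : ℝ) (x : V) (f : Conf V → ℝ≥0∞) (η : Conf V) :
    ℝ≥0∞ := ∑ i, wt K lam x i * f (act x i η)

lemma mem_activeSites (η : Conf V) (x : V) : x ∈ activeSites η ↔ ∃ n, η x = Site.active n := by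
  unfold activeSites
  simp only [Finset.mem_filter, Finset.mem_univ, true_and]
  cases h : η x <;> simp [Site.isActive]

lemma addActive_active (s : Site) : ∃ n, s.addActive = Site.active n := by
  cases s <;> simp [Site.addActive]

lemma act_keep {η : Conf V} {x y : V} (hxy : x ≠ y) (hy : y ∈ activeSites η)
    (i : Option (Option V)) : y ∈ activeSites (act x i η) := by
  rw [mem_activeSites] at *
  obtain ⟨n, hn⟩ := hy
  rcases i with _ | _ | z
  · simp only [act]
    split_ifs
    · exact ⟨n, by rw [Function.update_of_ne hxy.symm, hn]⟩
    · exact ⟨n, hn⟩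
  · exact ⟨n, by simp only [act]; rw [Function.update_of_ne hxy.symm, hn]⟩
  · simp only [act, addActiveAt]
    by_cases h : y = z
    · subst h
      simpa using addActive_active _
    · exact ⟨n, by rw [Function.update_of_ne h, Function.update_of_ne hxy.symm, hn]⟩

lemma add_keep {η : Conf V} {x : V} (hx : x ∈ activeSites η) (y : V) :
    x ∈ activeSites (addActiveAt η y) := by
  rw [mem_activeSites] at *
  obtain ⟨n, hn⟩ := hx
  unfold addActiveAt
  by_cases h : x = y
  · subst h
    simpa using addActive_active _
  · exact ⟨n, by rw [Function.update_of_ne h, hn]⟩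

lemma add_self (η : Conf V) (y : V) : y ∈ activeSites (addActiveAt η y) := by
  rw [mem_activeSites]
  simpa [addActiveAt] using addActive_active _

lemma addActiveAt_comm (η : Conf V) (y z : V) :
    addActiveAt (addActiveAt η y) z = addActiveAt (addActiveAt η z) y := by
  by_cases h : y = z
  · subst h; rfl
  · funext v
    unfold addActiveAt
    by_cases h1 : v = y <;> by_cases h2 : v = z <;> simp_all [Function.update_apply]

lemma removeOne_addActive {s : Site} {n : ℕ} (h : s = Site.active n) :
    s.addActive.removeOne = s := by subst h; rfl

lemma addActive_removeOne {s : Site} {n : ℕ} (h : s = Site.active n) :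
    s.removeOne.addActive = s := by subst h; cases n <;> rfl

lemma die_add {η : Conf V} {x : V} (hx : x ∈ activeSites η) (y : V) :
    act x (some none) (addActiveAt η y) = addActiveAt (act x (some none) η) y := by
  rw [mem_activeSites] at hx
  obtain ⟨n, hn⟩ := hx
  funext v
  simp only [act, addActiveAt, Function.update_apply]
  by_cases h1 : x = y
  · subst h1
    by_cases h2 : v = x
    · subst h2
      simp only [if_true]
      rw [removeOne_addActive hn, addActive_removeOne hn]
    · simp [h2]
  · by_cases h2 : v = x
    · subst h2; simp [h1]
    · by_cases h3 : v = y
      · subst h3; simp [h2]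
      · simp [h2, h3]

lemma act_add {η : Conf V} {x : V} (hx : x ∈ activeSites η) (y : V) (i : Option (Option V)) :
    act x i (addActiveAt η y) = addActiveAt (act x i η) y := by
  rcases i with _ | _ | z
  · rw [mem_activeSites] at hx
    obtain ⟨n, hn⟩ := hx
    simp only [act]
    by_cases h1 : x = y
    · subst h1
      have : addActiveAt η x x ≠ Site.active 0 := by
        simp [addActiveAt, hn, Site.addActive]
      rw [if_neg this]
      split_ifs with h
      · funext v
        simp only [addActiveAt, Function.update_apply]
        by_cases h2 : v = x <;> simp [h2, h, Site.addActive]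
      · rfl
    · have : addActiveAt η y x = η x := by simp [addActiveAt, Function.update_apply, h1]
      rw [this]
      split_ifs with h
      · funext v
        simp only [addActiveAt, Function.update_apply]
        by_cases h2 : v = x
        · subst h2; simp [h1]
        · by_cases h3 : v = y
          · subst h3; simp [h2]
          · simp [h2, h3]
      · rfl
  · exact die_add hx y
  · have := die_add hx y
    simp only [act] at this ⊢
    rw [this, addActiveAt_comm]

lemma act_comm {η : Conf V} {x y : V} (hxy : x ≠ y) (hx : x ∈ activeSites η)
    (hy : y ∈ activeSites η) (i j : Option (Option V)) :
    act x i (act y j η) = act y j (act x i η) := by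
  -- local actions
  have key : ∀ (a b : Site → Site), (Function.update (Function.update η y (b (η y))) x
      (a (Function.update η y (b (η y)) x))) =
      (Function.update (Function.update η x (a (η x))) y
      (b (Function.update η x (a (η x)) y))) := by
    intro a b
    rw [Function.update_of_ne hxy, Function.update_of_ne hxy.symm, Function.update_comm hxy]
  have loc : ∀ (i : Option (Option V)), (∀ z, i ≠ some (some z)) → ∃ a : Site → Site,
      ∀ (w : V) (σ : Conf V), act w i σ = Function.update σ w (a (σ w)) := by
    intro i hi
    rcases i with _ | _ | z
    · refine ⟨fun s => if s = Site.active 0 then Site.sleeping else s, fun w σ => ?_⟩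
      simp only [act]
      split_ifs <;> simp
    · exact ⟨Site.removeOne, fun w σ => rfl⟩
    · exact absurd rfl (hi z)
  have base : ∀ (i j : Option (Option V)), (∀ z, i ≠ some (some z)) → (∀ z, j ≠ some (some z)) →
      act x i (act y j η) = act y j (act x i η) := by
    intro i j hi hj
    obtain ⟨a, ha⟩ := loc i hi
    obtain ⟨b, hb⟩ := loc j hj
    rw [ha, hb, ha, hb]
    exact key a b
  have hjump : ∀ (w z : V) (σ : Conf V), act w (some (some z)) σ =
    addActiveAt (act w (some none) σ) z := fun _ _ _ => rfl
  by_cases hi : ∃ z, i = some (some z) <;> by_cases hj : ∃ z, j = some (some z)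
  · obtain ⟨z, rfl⟩ := hi
    obtain ⟨z', rfl⟩ := hj
    rw [hjump, hjump, hjump, hjump, die_add (act_keep hxy.symm hx _),
      die_add (act_keep hxy hy _), addActiveAt_comm, base _ _ (by simp) (by simp)]
  · obtain ⟨z, rfl⟩ := hi
    rw [hjump, hjump, act_add (act_keep hxy hy _), base _ _ (by simp) (by simpa using hj)]
  · obtain ⟨z, rfl⟩ := hj
    rw [hjump, hjump, act_add (act_keep hxy.symm hx _), base _ _ (by simpa using hi) (by simp)]
  · exact base _ _ (by simpa using hi) (by simpa using hj)

lemma embed_not_active (b : V → Bool) (x : V) : x ∉ activeSites (embed b) := by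
  rw [mem_activeSites]
  rintro ⟨n, hn⟩
  unfold embed at hn
  split_ifs at hn

lemma stable_embed {η : Conf V} (h : ¬ (activeSites η).Nonempty) : ∃ b, η = embed b := by
  refine ⟨fun x => decide (η x = Site.sleeping), ?_⟩
  funext x
  have : x ∉ activeSites η := fun hx => h ⟨x, hx⟩
  rw [mem_activeSites] at this
  unfold embed
  cases hx : η x
  · simp [hx]
  · simp [hx]
  · exact absurd ⟨_, hx⟩ this

lemma embed_inj {b b' : V → Bool} (h : embed b = embed b') : b = b' := by
  funext x
  have := congrFun h x
  unfold embed at this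
  cases h1 : b x <;> cases h2 : b' x <;> simp_all

/-- lazy stabilization within `n` topplings -/
noncomputable def lz (K : V → V → ℝ≥0∞) (lam : ℝ) (ξ : V → Bool) : ℕ → Conf V → ℝ≥0∞
  | 0 => fun η => if η = embed ξ then 1 else 0
  | n + 1 => fun η => if h : (activeSites η).Nonempty then top K lam h.choose (lz K lam ξ n) η
      else if η = embed ξ then 1 else 0

lemma top_congr (K : V → V → ℝ≥0∞) (lam : ℝ) (x : V) {f g : Conf V → ℝ≥0∞} {η : Conf V}
    (h : ∀ i, f (act x i η) = g (act x i η)) : top K lam x f η = top K lam x g η := by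
  unfold top
  exact Finset.sum_congr rfl fun i _ => by rw [h i]

lemma top_mono (K : V → V → ℝ≥0∞) (lam : ℝ) (x : V) {f g : Conf V → ℝ≥0∞} {η : Conf V}
    (h : ∀ i, f (act x i η) ≤ g (act x i η)) : top K lam x f η ≤ top K lam x g η := by
  unfold top
  exact Finset.sum_le_sum fun i _ => by gcongr; exact h i

lemma top_comm (K : V → V → ℝ≥0∞) (lam : ℝ) {x y : V} (hxy : x ≠ y) {η : Conf V}
    (hx : x ∈ activeSites η) (hy : y ∈ activeSites η) (f : Conf V → ℝ≥0∞) :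
    top K lam x (top K lam y f) η = top K lam y (top K lam x f) η := by
  unfold top
  simp only [Finset.mul_sum]
  rw [Finset.sum_comm]
  refine Finset.sum_congr rfl fun i _ => Finset.sum_congr rfl fun j _ => ?_
  rw [act_comm hxy hx hy, mul_left_comm]

lemma lz_zero_active (K : V → V → ℝ≥0∞) (lam : ℝ) (ξ : V → Bool) {η : Conf V} {x : V}
    (hx : x ∈ activeSites η) : lz K lam ξ 0 η = 0 := by
  simp only [lz]
  rw [if_neg]
  rintro rfl
  exact embed_not_active _ _ hx

lemma lz_stable (K : V → V → ℝ≥0∞) (lam : ℝ) (ξ b : V → Bool) (n : ℕ) :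
    lz K lam ξ n (embed b) = if b = ξ then 1 else 0 := by
  have h : ¬ (activeSites (embed b)).Nonempty := fun ⟨x, hx⟩ => embed_not_active _ _ hx
  have h2 : embed b = embed ξ ↔ b = ξ := ⟨embed_inj, fun h => by rw [h]⟩
  cases n <;> simp only [lz, h2]
  rw [dif_neg h]

lemma lz_succ (K : V → V → ℝ≥0∞) (lam : ℝ) (ξ : V → Bool) (n : ℕ) {η : Conf V}
    (h : (activeSites η).Nonempty) :
    lz K lam ξ (n + 1) η = top K lam h.choose (lz K lam ξ n) η := by
  change dite _ _ _ = _
  exact dif_pos h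

lemma lz_abel (K : V → V → ℝ≥0∞) (lam : ℝ) (ξ : V → Bool) (n : ℕ) : ∀ {η : Conf V} {x : V}
    (_ : x ∈ activeSites η), lz K lam ξ (n + 1) η = top K lam x (lz K lam ξ n) η := by
  induction n with
  | zero =>
    intro η x hx
    have h : (activeSites η).Nonempty := ⟨x, hx⟩
    rw [lz_succ K lam ξ _ h]
    by_cases hc : h.choose = x
    · rw [hc]
    · have hcm := h.choose_spec
      generalize h.choose = c at *
      unfold top
      refine (Finset.sum_eq_zero fun i _ => ?_).trans (Finset.sum_eq_zero fun i _ => ?_).symm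
      · rw [lz_zero_active K lam ξ (act_keep hc hx i), mul_zero]
      · rw [lz_zero_active K lam ξ (act_keep (Ne.symm hc) hcm i), mul_zero]
  | succ n ih =>
    intro η x hx
    have h : (activeSites η).Nonempty := ⟨x, hx⟩
    rw [lz_succ K lam ξ _ h]
    by_cases hc : h.choose = x
    · rw [hc]
    · have hcm := h.choose_spec
      generalize h.choose = c at *
      rw [top_congr K lam c (g := top K lam x (lz K lam ξ n)) (fun i => ih (act_keep hc hx i)),
        top_congr K lam x (g := top K lam c (lz K lam ξ n))
          (fun i => ih (act_keep (Ne.symm hc) hcm i)), top_comm K lam hc hcm hx]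

lemma lz_mono_succ (K : V → V → ℝ≥0∞) (lam : ℝ) (ξ : V → Bool) (n : ℕ) (η : Conf V) :
    lz K lam ξ n η ≤ lz K lam ξ (n + 1) η := by
  induction n generalizing η with
  | zero =>
    by_cases h : (activeSites η).Nonempty
    · obtain ⟨x, hx⟩ := h
      rw [lz_zero_active K lam ξ hx]; exact zero_le
    · obtain ⟨b, rfl⟩ := stable_embed h
      rw [lz_stable, lz_stable]
  | succ n ih =>
    by_cases h : (activeSites η).Nonempty
    · obtain ⟨x, hx⟩ := h
      rw [lz_abel K lam ξ _ hx, lz_abel K lam ξ _ hx]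
      exact top_mono K lam x fun i => ih _
    · obtain ⟨b, rfl⟩ := stable_embed h
      rw [lz_stable, lz_stable]

lemma lz_mono (K : V → V → ℝ≥0∞) (lam : ℝ) (ξ : V → Bool) (η : Conf V) :
    Monotone fun n => lz K lam ξ n η := monotone_nat_of_le_succ fun n => lz_mono_succ K lam ξ n η

noncomputable def st (K : V → V → ℝ≥0∞) (lam : ℝ) (η : Conf V) (ξ : V → Bool) : ℝ≥0∞ :=
  ⨆ n, lz K lam ξ n η

lemma st_embed (K : V → V → ℝ≥0∞) (lam : ℝ) (b ξ : V → Bool) :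
    st K lam (embed b) ξ = if b = ξ then 1 else 0 := by
  unfold st
  simp only [lz_stable, ciSup_const]

lemma top_iSup (K : V → V → ℝ≥0∞) (lam : ℝ) (x : V) (f : ℕ → Conf V → ℝ≥0∞)
    (hf : ∀ η, Monotone fun n => f n η) (η : Conf V) :
    top K lam x (fun σ => ⨆ n, f n σ) η = ⨆ n, top K lam x (f n) η := by
  unfold top
  simp only [ENNReal.mul_iSup]
  rw [ENNReal.finsetSum_iSup_of_monotone]
  intro i m n h
  simp only
  gcongr
  exact hf _ h

lemma st_top (K : V → V → ℝ≥0∞) (lam : ℝ) {η : Conf V} (ξ : V → Bool) {x : V}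
    (hx : x ∈ activeSites η) : st K lam η ξ = top K lam x (fun σ => st K lam σ ξ) η := by
  unfold st
  rw [top_iSup K lam x _ (fun η => lz_mono K lam ξ η)]
  simp only [← lz_abel K lam ξ _ hx]
  exact ((lz_mono K lam ξ η).iSup_nat_add 1).symm

lemma wt_sum (K : V → V → ℝ≥0∞) (hsub : SubStochastic K) (lam : ℝ) (x : V) :
    ∑ i, wt K lam x i = 1 := by
  rw [Fintype.sum_option, Fintype.sum_option]
  simp only [wt, div_eq_mul_inv]
  rw [← Finset.sum_mul, ← add_mul, ← add_mul, tsub_add_cancel_of_le (hsub x)]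
  exact ENNReal.mul_inv_cancel (by simp) (by simp)

lemma lz_le_one (K : V → V → ℝ≥0∞) (hsub : SubStochastic K) (lam : ℝ) (ξ : V → Bool) (n : ℕ)
    (η : Conf V) : lz K lam ξ n η ≤ 1 := by
  induction n generalizing η with
  | zero => simp only [lz]; split_ifs <;> simp
  | succ n ih =>
    by_cases h : (activeSites η).Nonempty
    · obtain ⟨x, hx⟩ := h
      rw [lz_abel K lam ξ _ hx, ← wt_sum K hsub lam x]
      unfold top
      exact Finset.sum_le_sum fun i _ => mul_le_of_le_one_right' (ih _)
    · obtain ⟨b, rfl⟩ := stable_embed h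
      rw [lz_stable]; split_ifs <;> simp

lemma st_le_one (K : V → V → ℝ≥0∞) (hsub : SubStochastic K) (lam : ℝ) (ξ : V → Bool)
    (η : Conf V) : st K lam η ξ ≤ 1 := iSup_le fun n => lz_le_one K hsub lam ξ n η

lemma st_ne_top (K : V → V → ℝ≥0∞) (hsub : SubStochastic K) (lam : ℝ) (ξ : V → Bool)
    (η : Conf V) : st K lam η ξ ≠ ⊤ := ((st_le_one K hsub lam ξ η).trans_lt (by simp)).ne

/-- move part -/
noncomputable def mv (K : V → V → ℝ≥0∞) (x : V) (f : Conf V → ℝ≥0∞) (η : Conf V) : ℝ≥0∞ :=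
  ∑ y, K x y * f (act x (some (some y)) η) + (1 - ∑ y, K x y) * f (act x (some none) η)

lemma top_eq (K : V → V → ℝ≥0∞) (lam : ℝ) (x : V) (f : Conf V → ℝ≥0∞) (η : Conf V) :
    top K lam x f η =
      (ENNReal.ofReal lam * f (act x none η) + mv K x f η) / (ENNReal.ofReal lam + 1) := by
  unfold top mv
  rw [Fintype.sum_option, Fintype.sum_option]
  simp only [wt, div_eq_mul_inv, add_mul, Finset.sum_mul]
  rw [add_comm (∑ y, _ )]
  simp only [mul_right_comm]

lemma lazy_cancel (lam : ℝ) (a b : ℝ≥0∞) (ha : a ≠ ⊤) :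
    a = (ENNReal.ofReal lam * a + b) / (ENNReal.ofReal lam + 1) ↔ a = b := by
  rw [ENNReal.eq_div_iff (by simp) (by simp), add_mul, one_mul]
  exact ENNReal.add_right_inj (ENNReal.mul_ne_top (by simp) ha)

lemma st_mv (K : V → V → ℝ≥0∞) (hsub : SubStochastic K) (lam : ℝ) {η : Conf V} (ξ : V → Bool)
    {x : V} (hx : x ∈ activeSites η) (h0 : η x ≠ Site.active 0) :
    st K lam η ξ = mv K x (fun σ => st K lam σ ξ) η := by
  have := st_top K lam ξ hx
  rw [top_eq] at this
  simp only [act, if_neg h0] at this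
  rwa [lazy_cancel _ _ _ (st_ne_top K hsub lam ξ η)] at this

/-! comparison with the kernel -/

noncomputable def tk (K : V → V → ℝ≥0∞) (lam : ℝ) (x : V) (f : Conf V → ℝ≥0∞) (η : Conf V) :
    ℝ≥0∞ :=
  if η x = Site.active 0 then
    (ENNReal.ofReal lam * f (act x none η) + mv K x f η) / (ENNReal.ofReal lam + 1)
  else mv K x f η

lemma tsum_topple (K : V → V → ℝ≥0∞) (lam : ℝ) (f : Conf V → ℝ≥0∞) (η : Conf V)
    (h : (activeSites η).Nonempty) :
    ∑' σ, toppleKernel K lam η σ * f σ = tk K lam h.choose f η := by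
  have e1 : ∀ (τ : Conf V) (a : ℝ≥0∞), ∑' σ, (if σ = τ then a else 0) * f σ = a * f τ := by
    intro τ a
    rw [tsum_eq_single τ]
    · simp
    · intro b hb; simp [hb]
  unfold toppleKernel tk
  simp only [dif_pos h]
  generalize h.choose = x
  have e2 : ∑' σ, ((∑ y, if σ = addActiveAt (Function.update η x (η x).removeOne) y then K x y
      else 0) + (if σ = Function.update η x (η x).removeOne then 1 - ∑ y, K x y else 0)) * f σ
      = mv K x f η := by
    simp only [add_mul, Finset.sum_mul]
    rw [ENNReal.tsum_add, e1, Summable.tsum_finsetSum (fun _ _ => ENNReal.summable)]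
    simp only [e1]
    rfl
  split_ifs with h0
  · simp only [div_eq_mul_inv, mul_right_comm _ (_⁻¹)]
    rw [ENNReal.tsum_mul_right]
    congr 1
    simp only [add_assoc]
    simp only [add_mul _ (_ + _)]
    rw [ENNReal.tsum_add, e1, e2]
    simp only [act, if_pos h0]
  · exact e2

lemma kp_stable (K : V → V → ℝ≥0∞) (lam : ℝ) (t : ℕ) (b : V → Bool) (ξ : Conf V) :
    kernelPow (toppleKernel K lam) t (embed b) ξ = if ξ = embed b then 1 else 0 := by
  induction t with
  | zero => rfl
  | succ t ih =>
    have h : ¬ (activeSites (embed b)).Nonempty := fun ⟨x, hx⟩ => embed_not_active _ _ hx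
    simp only [kernelPow]
    rw [tsum_eq_single (embed b), ih]
    · unfold toppleKernel
      rw [dif_neg h]; simp
    · intro σ hσ
      unfold toppleKernel
      rw [dif_neg h, if_neg hσ, zero_mul]

lemma mv_mono (K : V → V → ℝ≥0∞) (x : V) {f g : Conf V → ℝ≥0∞} (h : ∀ σ, f σ ≤ g σ)
    (η : Conf V) : mv K x f η ≤ mv K x g η := by
  unfold mv
  gcongr <;> exact h _

lemma tk_mono (K : V → V → ℝ≥0∞) (lam : ℝ) (x : V) {f g : Conf V → ℝ≥0∞} (h : ∀ σ, f σ ≤ g σ)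
    (η : Conf V) : tk K lam x f η ≤ tk K lam x g η := by
  unfold tk
  split_ifs
  · gcongr
    · exact h _
    · exact mv_mono K x h η
  · exact mv_mono K x h η

lemma kp_succ (K : V → V → ℝ≥0∞) (lam : ℝ) (t : ℕ) (η ξ : Conf V)
    (h : (activeSites η).Nonempty) :
    kernelPow (toppleKernel K lam) (t + 1) η ξ =
      tk K lam h.choose (fun σ => kernelPow (toppleKernel K lam) t σ ξ) η := by
  rw [← tsum_topple]; rfl

lemma kp_mono_succ (K : V → V → ℝ≥0∞) (lam : ℝ) (t : ℕ) (η : Conf V) (ξ : V → Bool) :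
    kernelPow (toppleKernel K lam) t η (embed ξ) ≤
      kernelPow (toppleKernel K lam) (t + 1) η (embed ξ) := by
  induction t generalizing η with
  | zero =>
    by_cases h : (activeSites η).Nonempty
    · simp only [kernelPow]
      rw [if_neg]
      · exact zero_le
      · rintro rfl
        obtain ⟨x, hx⟩ := h
        exact embed_not_active _ _ hx
    · obtain ⟨b, rfl⟩ := stable_embed h
      rw [kp_stable, kp_stable]
  | succ t ih =>
    by_cases h : (activeSites η).Nonempty
    · rw [kp_succ _ _ _ _ _ h, kp_succ _ _ _ _ _ h]
      exact tk_mono K lam _ ih η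
    · obtain ⟨b, rfl⟩ := stable_embed h
      rw [kp_stable, kp_stable]

lemma mv_iSup (K : V → V → ℝ≥0∞) (x : V) (f : ℕ → Conf V → ℝ≥0∞)
    (hf : ∀ η, Monotone fun n => f n η) (η : Conf V) :
    mv K x (fun σ => ⨆ n, f n σ) η = ⨆ n, mv K x (f n) η := by
  unfold mv
  simp only [ENNReal.mul_iSup]
  rw [ENNReal.finsetSum_iSup_of_monotone, ENNReal.iSup_add_iSup_of_monotone]
  · intro m n h
    simp only
    gcongr
    exact hf _ h
  · intro m n h
    simp only
    gcongr
    exact hf _ h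
  · intro i m n h
    simp only
    gcongr
    exact hf _ h

lemma st_tk (K : V → V → ℝ≥0∞) (hsub : SubStochastic K) (lam : ℝ) {η : Conf V} (ξ : V → Bool)
    {x : V} (hx : x ∈ activeSites η) :
    st K lam η ξ = tk K lam x (fun σ => st K lam σ ξ) η := by
  unfold tk
  split_ifs with h
  · rw [← top_eq K lam x (fun σ => st K lam σ ξ)]; exact st_top K lam ξ hx
  · exact st_mv K hsub lam ξ hx h

lemma kp_le_st (K : V → V → ℝ≥0∞) (hsub : SubStochastic K) (lam : ℝ) (t : ℕ) (η : Conf V)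
    (ξ : V → Bool) : kernelPow (toppleKernel K lam) t η (embed ξ) ≤ st K lam η ξ := by
  induction t generalizing η with
  | zero =>
    simp only [kernelPow]
    split_ifs with h
    · rw [← h, st_embed]; simp
    · exact zero_le
  | succ t ih =>
    by_cases h : (activeSites η).Nonempty
    · rw [kp_succ _ _ _ _ _ h, st_tk K hsub lam ξ h.choose_spec]
      exact tk_mono K lam _ ih η
    · obtain ⟨b, rfl⟩ := stable_embed h
      rw [kp_stable, st_embed]
      split_ifs with h1 h2 h2
      · exact le_rfl
      · exact absurd (embed_inj h1.symm) h2
      · exact zero_le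
      · exact le_rfl

lemma lz_le_kp (K : V → V → ℝ≥0∞) (hsub : SubStochastic K) (lam : ℝ) (n : ℕ) (η : Conf V)
    (ξ : V → Bool) :
    lz K lam ξ n η ≤ ⨆ t, kernelPow (toppleKernel K lam) t η (embed ξ) := by
  induction n generalizing η with
  | zero =>
    refine le_iSup_of_le 0 ?_
    simp only [lz, kernelPow]
    simp only [eq_comm (a := η)]
    exact le_rfl
  | succ n ih =>
    by_cases h : (activeSites η).Nonempty
    · have hm : ∀ σ, Monotone fun t => kernelPow (toppleKernel K lam) t σ (embed ξ) :=
        fun σ => monotone_nat_of_le_succ fun n => kp_mono_succ K lam n σ ξ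
      have e : (⨆ t, kernelPow (toppleKernel K lam) t η (embed ξ)) =
          tk K lam h.choose
            (fun σ => ⨆ t, kernelPow (toppleKernel K lam) t σ (embed ξ)) η := by
        rw [← (hm η).iSup_nat_add 1]
        simp only [kp_succ _ _ _ _ _ h]
        unfold tk
        rw [mv_iSup K _ _ hm]
        split_ifs
        · rw [← ENNReal.iSup_div, ENNReal.mul_iSup, ENNReal.iSup_add_iSup_of_monotone]
          · intro m n h
            simp only
            gcongr
            exact hm _ h
          · intro m n h
            exact mv_mono K _ (fun σ => hm σ h) _
        · rfl
      rw [lz_abel K lam ξ n h.choose_spec]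
      refine (top_mono K lam _ (g := fun σ => ⨆ t, kernelPow (toppleKernel K lam) t σ (embed ξ))
        fun i => ih _).trans ?_
      rw [top_eq]
      conv_rhs => rw [e]
      unfold tk
      split_ifs with h0
      · exact le_rfl
      · have e' := e
        unfold tk at e'
        rw [if_neg h0] at e'
        rw [← e', act, if_neg h0]
        have hfin : (⨆ t, kernelPow (toppleKernel K lam) t η (embed ξ)) ≠ ⊤ :=
          ((iSup_le fun t => (kp_le_st K hsub lam t η ξ).trans
            (st_le_one K hsub lam ξ η)).trans_lt (by simp)).ne
        exact ((lazy_cancel lam _ _ hfin).2 rfl).symm.le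
    · obtain ⟨b, rfl⟩ := stable_embed h
      refine le_iSup_of_le 0 ?_
      rw [lz_stable, kp_stable]
      split_ifs with h1 h2 h2
      · exact le_rfl
      · exact absurd (by rw [h1]) h2
      · exact zero_le
      · exact le_rfl

lemma iSup_kp (K : V → V → ℝ≥0∞) (hsub : SubStochastic K) (lam : ℝ) (η : Conf V)
    (ξ : V → Bool) :
    ⨆ t, kernelPow (toppleKernel K lam) t η (embed ξ) = st K lam η ξ :=
  le_antisymm (iSup_le fun t => kp_le_st K hsub lam t η ξ)
    (iSup_le fun n => lz_le_kp K hsub lam n η ξ)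

lemma st_add (K : V → V → ℝ≥0∞) (lam : ℝ) (σ : Conf V) (y : V)
    (ξ' : V → Bool) :
    ∑ ξ, st K lam σ ξ * st K lam (addActiveAt (embed ξ) y) ξ' = st K lam (addActiveAt σ y) ξ' := by
  have hG : ∀ b, ∑ ξ, st K lam (embed b) ξ * st K lam (addActiveAt (embed ξ) y) ξ'
      = st K lam (addActiveAt (embed b) y) ξ' := by
    intro b
    simp [st_embed]
  have htop : ∀ (σ : Conf V) (x : V) (f : (V → Bool) → Conf V → ℝ≥0∞) (g : (V → Bool) → ℝ≥0∞),
      ∑ ξ, top K lam x (f ξ) σ * g ξ = top K lam x (fun τ => ∑ ξ, f ξ τ * g ξ) σ := by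
    intro σ x f g
    unfold top
    simp only [Finset.sum_mul, Finset.mul_sum]
    rw [Finset.sum_comm]
    simp only [mul_assoc]
  apply le_antisymm
  · unfold st
    simp only [ENNReal.iSup_mul]
    rw [ENNReal.finsetSum_iSup_of_monotone]
    swap
    · intro i m n h
      simp only
      gcongr
      exact lz_mono K lam i σ h
    refine iSup_le fun n => ?_
    change ∑ ξ, lz K lam ξ n σ * st K lam (addActiveAt (embed ξ) y) ξ'
      ≤ st K lam (addActiveAt σ y) ξ'
    induction n generalizing σ with
    | zero =>
      by_cases h : (activeSites σ).Nonempty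
      · obtain ⟨x, hx⟩ := h
        simp [lz_zero_active K lam _ hx]
      · obtain ⟨b, rfl⟩ := stable_embed h
        simp [lz_stable]
    | succ n ih =>
      by_cases h : (activeSites σ).Nonempty
      · obtain ⟨x, hx⟩ := h
        simp only [lz_abel K lam _ _ hx]
        rw [htop, st_top K lam ξ' (add_keep hx y)]
        unfold top
        refine Finset.sum_le_sum fun i _ => ?_
        gcongr
        rw [act_add hx]
        exact ih _
      · obtain ⟨b, rfl⟩ := stable_embed h
        simp [lz_stable]
  · refine iSup_le fun n => ?_
    induction n generalizing σ with
    | zero => rw [lz_zero_active K lam _ (add_self σ y)]; exact zero_le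
    | succ n ih =>
      by_cases h : (activeSites σ).Nonempty
      · obtain ⟨x, hx⟩ := h
        rw [lz_abel K lam _ _ (add_keep hx y)]
        simp only [st_top K lam _ hx]
        rw [htop]
        unfold top
        refine Finset.sum_le_sum fun i _ => ?_
        gcongr
        rw [act_add hx]
        exact ih _
      · obtain ⟨b, rfl⟩ := stable_embed h
        rw [hG]
        exact le_iSup (fun n => lz K lam ξ' n (addActiveAt (embed b) y)) (n + 1)

end
end ARW
namespace ARW

section
set_option linter.unusedSectionVars false
variable {V : Type} [Fintype V] [DecidableEq V]

def listE (V : Type) : Unit ⊕ (V × List V) ≃ List V where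
  toFun | .inl _ => [] | .inr (y, ys) => y :: ys
  invFun | [] => .inl () | y :: ys => .inr (y, ys)
  left_inv := by rintro (_ | ⟨y, ys⟩) <;> rfl
  right_inv := by rintro (_ | ⟨y, ys⟩) <;> rfl

lemma tsum_list (f : List V → ℝ≥0∞) : ∑' w, f w = f [] + ∑ y, ∑' ws, f (y :: ws) := by
  rw [← (listE V).tsum_eq f, Summable.tsum_sum ENNReal.summable ENNReal.summable,
    tsum_fintype]
  change _ + ∑' p : V × List V, f (p.1 :: p.2) = _
  rw [ENNReal.tsum_prod (f := fun y ws => f (y :: ws)), tsum_fintype]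
  simp [listE]

noncomputable def av (K : V → V → ℝ≥0∞) (S : Finset V) (y : V) : ℝ≥0∞ :=
  ∑' w : List V, if ∀ v ∈ y :: w, v ∈ S then pathProb K y w else 0

lemma av_not_mem (K : V → V → ℝ≥0∞) {S : Finset V} {y : V} (h : y ∉ S) : av K S y = 0 := by
  unfold av
  simp [h]

lemma av_mem (K : V → V → ℝ≥0∞) {S : Finset V} {y : V} (h : y ∈ S) :
    av K S y = ∑ z, K y z * av K S z + (1 - ∑ z, K y z) := by
  unfold av
  rw [tsum_list, add_comm]
  congr 1
  · refine Finset.sum_congr rfl fun z _ => ?_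
    rw [← ENNReal.tsum_mul_left]
    refine tsum_congr fun w => ?_
    simp [h, pathProb]
  · simp [h, pathProb]

lemma path_trunc (K : V → V → ℝ≥0∞) (hsub : SubStochastic K) (n : ℕ) (y : V) :
    (∑' w : List V, if w.length ≤ n then pathProb K y w else 0) ≤ 1 := by
  induction n generalizing y with
  | zero =>
    rw [tsum_list]
    simp [pathProb]
  | succ n ih =>
    rw [tsum_list]
    have : ∀ z, (∑' ws : List V, if (z :: ws).length ≤ n + 1 then pathProb K y (z :: ws) else 0)
        ≤ K y z := by
      intro z
      calc _ = K y z * ∑' ws : List V, (if ws.length ≤ n then pathProb K z ws else 0) := by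
            rw [← ENNReal.tsum_mul_left]
            refine tsum_congr fun w => ?_
            simp [pathProb]
        _ ≤ K y z * 1 := by gcongr; exact ih z
        _ = K y z := mul_one _
    calc _ ≤ (1 - ∑ z, K y z) + ∑ z, K y z := by
          refine add_le_add (by simp [pathProb]) (Finset.sum_le_sum fun z _ => this z)
      _ = 1 := tsub_add_cancel_of_le (hsub y)

lemma path_le_one (K : V → V → ℝ≥0∞) (hsub : SubStochastic K) (y : V) :
    ∑' w : List V, pathProb K y w ≤ 1 := by
  rw [ENNReal.tsum_eq_iSup_sum]
  refine iSup_le fun s => ?_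
  refine le_trans ?_ (path_trunc K hsub (s.sup List.length) y)
  refine le_trans (Finset.sum_le_sum fun w hw => ?_) (ENNReal.sum_le_tsum s)
  rw [if_pos (Finset.le_sup (f := List.length) hw)]

lemma av_univ_eq (K : V → V → ℝ≥0∞) (y : V) :
    av K Finset.univ y = ∑' w : List V, pathProb K y w := by
  simp [av]

lemma av_mono (K : V → V → ℝ≥0∞) {S T : Finset V} (h : S ⊆ T) (y : V) :
    av K S y ≤ av K T y := by
  unfold av
  refine ENNReal.tsum_le_tsum fun w => ?_
  split_ifs with h1 h2
  · exact le_rfl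
  · exact absurd (fun v hv => h (h1 v hv)) h2
  · exact zero_le
  · exact le_rfl

lemma av_le_one (K : V → V → ℝ≥0∞) (hsub : SubStochastic K) (S : Finset V) (y : V) :
    av K S y ≤ 1 :=
  (av_mono K (Finset.subset_univ S) y).trans ((av_univ_eq K y).le.trans (path_le_one K hsub y))

lemma av_ne_top (K : V → V → ℝ≥0∞) (hsub : SubStochastic K) (S : Finset V) (y : V) :
    av K S y ≠ ⊤ := ((av_le_one K hsub S y).trans_lt (by simp)).ne

lemma K_ne_top (K : V → V → ℝ≥0∞) (hsub : SubStochastic K) (x y : V) : K x y ≠ ⊤ :=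
  (((Finset.single_le_sum (f := K x) (fun _ _ => zero_le) (Finset.mem_univ y)).trans
    (hsub x)).trans_lt (by simp)).ne

lemma kap_eq (K : V → V → ℝ≥0∞) (hsub : SubStochastic K) (x : V) :
    (1 - ∑ y, K x y).toReal = 1 - ∑ y, (K x y).toReal := by
  rw [ENNReal.toReal_sub_of_le (hsub x) (by simp),
    ENNReal.toReal_sum (fun y _ => K_ne_top K hsub x y)]
  simp

lemma uniq (K : V → V → ℝ≥0∞) (hsub : SubStochastic K) (hnd : NonDegenerate K)
    (S : Finset V) (d : V → ℂ) (h0 : ∀ y ∉ S, d y = 0)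
    (h1 : ∀ y ∈ S, d y = ∑ z, ((K y z).toReal : ℂ) * d z) (y : V) : d y = 0 := by
  by_contra hy
  have : Nonempty V := ⟨y⟩
  obtain ⟨x0, hx0⟩ := Finite.exists_max fun v => ‖d v‖
  set M := ‖d x0‖ with hM
  have hMpos : 0 < M := (norm_pos_iff.2 hy).trans_le (hx0 y)
  obtain ⟨x, hxT, hx⟩ := hnd (Finset.univ.filter fun v => ‖d v‖ = M) ⟨x0, by simp [hM]⟩
  apply hx
  have hxM : ‖d x‖ = M := by simpa using hxT
  have hxS : x ∈ S := by
    by_contra h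
    rw [h0 x h, norm_zero] at hxM
    exact hMpos.ne hxM
  have hle : M ≤ ∑ z, (K x z).toReal * ‖d z‖ := by
    calc M = ‖∑ z, ((K x z).toReal : ℂ) * d z‖ := by rw [← h1 x hxS, hxM]
      _ ≤ ∑ z, ‖((K x z).toReal : ℂ) * d z‖ := norm_sum_le _ _
      _ = _ := by
        refine Finset.sum_congr rfl fun z _ => ?_
        rw [norm_mul, Complex.norm_real, Real.norm_of_nonneg ENNReal.toReal_nonneg]
  have hk1 : ∑ z, (K x z).toReal ≤ 1 := by
    have := kap_eq K hsub x
    have h2 : 0 ≤ (1 - ∑ y, K x y).toReal := ENNReal.toReal_nonneg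
    linarith
  have hterm : ∀ z, 0 ≤ (K x z).toReal * (M - ‖d z‖) := fun z =>
    mul_nonneg ENNReal.toReal_nonneg (sub_nonneg.2 (hx0 z))
  have hsum : ∑ z, (K x z).toReal * (M - ‖d z‖) =
      (∑ z, (K x z).toReal) * M - ∑ z, (K x z).toReal * ‖d z‖ := by
    simp only [mul_sub, Finset.sum_sub_distrib, Finset.sum_mul]
  have hnn := Finset.sum_nonneg fun z (_ : z ∈ Finset.univ) => hterm z
  have hzero : ∑ z, (K x z).toReal * (M - ‖d z‖) = 0 := by
    apply le_antisymm _ hnn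
    nlinarith
  have hk : ∑ z, (K x z).toReal = 1 := by
    apply le_antisymm hk1
    by_contra h
    push Not at h
    nlinarith
  have hz := (Finset.sum_eq_zero_iff_of_nonneg fun z _ => hterm z).1 hzero
  have hT : ∑ z ∈ Finset.univ.filter (fun v => ‖d v‖ = M), (K x z).toReal = 1 := by
    rw [← hk]
    refine Finset.sum_subset (Finset.subset_univ _) fun z _ hzT => ?_
    have hne : ‖d z‖ ≠ M := by simpa using hzT
    rcases mul_eq_zero.1 (hz z (Finset.mem_univ z)) with h | h
    · exact h
    · exact absurd (by linarith) hne
  rw [← ENNReal.toReal_sum (fun z _ => K_ne_top K hsub x z)] at hT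
  rwa [ENNReal.toReal_eq_one_iff] at hT

lemma solve (K : V → V → ℝ≥0∞) (hsub : SubStochastic K) (hnd : NonDegenerate K)
    (S : Finset V) (u : V → ℂ) (c : ℂ) (h0 : ∀ y ∉ S, u y = 0)
    (h1 : ∀ y ∈ S, u y = ∑ z, ((K y z).toReal : ℂ) * u z +
      ((1 - ∑ z, K y z).toReal : ℂ) * c) (y : V) : u y = c * ((av K S y).toReal : ℂ) := by
  have := uniq K hsub hnd S (fun y => u y - c * ((av K S y).toReal : ℂ)) ?_ ?_ y
  · exact sub_eq_zero.1 this
  · intro y hy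
    simp [h0 y hy, av_not_mem K hy]
  · intro y hy
    have e : (av K S y).toReal = ∑ z, (K y z).toReal * (av K S z).toReal +
        (1 - ∑ z, K y z).toReal := by
      rw [av_mem K hy, ENNReal.toReal_add, ENNReal.toReal_sum]
      · simp only [ENNReal.toReal_mul]
      · exact fun z _ => ENNReal.mul_ne_top (K_ne_top K hsub y z) (av_ne_top K hsub S z)
      · exact ENNReal.sum_ne_top.2 fun z _ =>
          ENNReal.mul_ne_top (K_ne_top K hsub y z) (av_ne_top K hsub S z)
      · exact (tsub_le_self.trans_lt (by simp)).ne
    rw [h1 y hy, e]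
    push_cast
    simp only [mul_sub, Finset.sum_sub_distrib, mul_add, Finset.mul_sum]
    have : ∀ z, ((K y z).toReal : ℂ) * (c * ((av K S z).toReal : ℂ)) =
      c * (((K y z).toReal : ℂ) * ((av K S z).toReal : ℂ)) := fun z => by ring
    simp only [this]
    ring

lemma av_univ (K : V → V → ℝ≥0∞) (hsub : SubStochastic K) (hnd : NonDegenerate K) (y : V) :
    av K Finset.univ y = 1 := by
  have := solve K hsub hnd Finset.univ (fun _ => 1) 1 (by simp) (fun y _ => by
    rw [kap_eq K hsub]; push_cast; simp) y
  rw [one_mul] at this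
  have h : (av K Finset.univ y).toReal = 1 := by exact_mod_cast this.symm
  rwa [ENNReal.toReal_eq_one_iff] at h

/-- probability that the walk stays in `S` -/
noncomputable def stay (K : V → V → ℝ≥0∞) (ν : V → ℝ≥0∞) (S : Finset V) : ℝ≥0∞ :=
  ∑ y, ν y * av K S y

lemma hit_add_stay (K : V → V → ℝ≥0∞) (hsub : SubStochastic K) (hnd : NonDegenerate K)
    (ν : V → ℝ≥0∞) (hν : IsProbVec ν) (x : V) :
    hitProb K ν x + stay K ν (Finset.univ.erase x) = 1 := by
  unfold hitProb stay
  rw [tsum_list]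
  simp only [List.not_mem_nil, if_false, zero_add]
  rw [← Finset.sum_add_distrib]
  rw [← hν]
  refine Finset.sum_congr rfl fun y _ => ?_
  have : ∑' ws : List V, (if x ∈ y :: ws then walkProb K ν (y :: ws) else 0) =
      ν y * ∑' ws : List V, (if x ∈ y :: ws then pathProb K y ws else 0) := by
    rw [← ENNReal.tsum_mul_left]
    refine tsum_congr fun w => ?_
    simp only [walkProb]
    split_ifs <;> simp
  rw [this, ← mul_add, av, ← ENNReal.tsum_add]
  conv_rhs => rw [← mul_one (ν y), ← av_univ K hsub hnd y, av_univ_eq]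
  congr 1
  refine tsum_congr fun w => ?_
  have : (∀ v ∈ y :: w, v ∈ Finset.univ.erase x) ↔ x ∉ y :: w := by
    simp only [Finset.mem_erase, Finset.mem_univ, and_true]
    exact ⟨fun h hx => h x hx rfl, fun h v hv e => h (e ▸ hv)⟩
  simp only [this]
  split_ifs <;> simp_all

lemma ν_ne_top (ν : V → ℝ≥0∞) (hν : IsProbVec ν) (y : V) : ν y ≠ ⊤ :=
  (((Finset.single_le_sum (f := ν) (fun _ _ => zero_le) (Finset.mem_univ y)).trans
    hν.le).trans_lt (by simp)).ne

lemma stay_toReal (K : V → V → ℝ≥0∞) (hsub : SubStochastic K) 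
    (ν : V → ℝ≥0∞) (hν : IsProbVec ν) (S : Finset V) :
    (stay K ν S).toReal = ∑ y, (ν y).toReal * (av K S y).toReal := by
  unfold stay
  rw [ENNReal.toReal_sum]
  · simp only [ENNReal.toReal_mul]
  · exact fun y _ => ENNReal.mul_ne_top (ν_ne_top ν hν y) (av_ne_top K hsub S y)

lemma stay_mono (K : V → V → ℝ≥0∞) (ν : V → ℝ≥0∞) {S T : Finset V} (h : S ⊆ T) :
    stay K ν S ≤ stay K ν T := by
  unfold stay
  gcongr
  exact av_mono K h _

lemma hit_le_one (K : V → V → ℝ≥0∞) (hsub : SubStochastic K) (hnd : NonDegenerate K)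
    (ν : V → ℝ≥0∞) (hν : IsProbVec ν) (x : V) : hitProb K ν x ≤ 1 :=
  le_self_add.trans (hit_add_stay K hsub hnd ν hν x).le

lemma stay_erase (K : V → V → ℝ≥0∞) (hsub : SubStochastic K) (hnd : NonDegenerate K)
    (ν : V → ℝ≥0∞) (hν : IsProbVec ν) (x : V) :
    (stay K ν (Finset.univ.erase x)).toReal = 1 - (hitProb K ν x).toReal := by
  have h := hit_add_stay K hsub hnd ν hν x
  have h2 := congrArg ENNReal.toReal h
  have h3 : stay K ν (Finset.univ.erase x) ≤ 1 := le_add_self.trans h.le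
  rw [ENNReal.toReal_add ((hit_le_one K hsub hnd ν hν x).trans_lt (by simp)).ne
    (h3.trans_lt (by simp)).ne] at h2
  simp at h2
  linarith

/-! Linear relations -/

noncomputable def sr (K : V → V → ℝ≥0∞) (lam : ℝ) (σ : Conf V) (ξ : V → Bool) : ℝ :=
  (st K lam σ ξ).toReal

lemma sr_walk (K : V → V → ℝ≥0∞) (hsub : SubStochastic K) (lam : ℝ) (σ : Conf V) (ξ : V → Bool)
    (y : V) (n : ℕ) (hy : σ y = Site.active n) :
    sr K lam (addActiveAt σ y) ξ = ∑ z, (K y z).toReal * sr K lam (addActiveAt σ z) ξ +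
      (1 - ∑ z, K y z).toReal * sr K lam σ ξ := by
  have h := st_mv K hsub lam ξ (add_self σ y) (by simp [addActiveAt, hy, Site.addActive])
  have hd : act y (some none) (addActiveAt σ y) = σ := by
    simp [act, addActiveAt, removeOne_addActive hy]
  have hj : ∀ z, act y (some (some z)) (addActiveAt σ y) = addActiveAt σ z := fun z => by
    change addActiveAt (act y (some none) (addActiveAt σ y)) z = _
    rw [hd]
  unfold mv at h
  simp only [hd, hj] at h
  unfold sr
  have hf : ∀ z ∈ Finset.univ, K y z * st K lam (addActiveAt σ z) ξ ≠ ⊤ := fun z _ =>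
    ENNReal.mul_ne_top (K_ne_top K hsub y z) (st_ne_top K hsub lam ξ _)
  rw [h, ENNReal.toReal_add, ENNReal.toReal_sum hf]
  · simp only [ENNReal.toReal_mul]
  · exact ENNReal.sum_ne_top.2 hf
  · exact ENNReal.mul_ne_top (tsub_le_self.trans_lt (by simp)).ne (st_ne_top K hsub lam ξ _)

lemma arw_apply (K : V → V → ℝ≥0∞) (hsub : SubStochastic K) (lam : ℝ) 
    (ν : V → ℝ≥0∞) (hν : IsProbVec ν) (η ξ : V → Bool) :
    arwMatrix K lam ν η ξ = ∑ y, (ν y).toReal * sr K lam (addActiveAt (embed η) y) ξ := by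
  unfold arwMatrix arwStep sr
  simp only [Matrix.of_apply, iSup_kp K hsub]
  rw [ENNReal.toReal_sum]
  · simp only [ENNReal.toReal_mul]
  · exact fun y _ => ENNReal.mul_ne_top (ν_ne_top ν hν y) (st_ne_top K hsub lam ξ _)

lemma sr_add (K : V → V → ℝ≥0∞) (hsub : SubStochastic K) (lam : ℝ) (σ : Conf V) (y : V)
    (ξ' : V → Bool) :
    ∑ ξ, sr K lam σ ξ * sr K lam (addActiveAt (embed ξ) y) ξ' = sr K lam (addActiveAt σ y) ξ' := by
  unfold sr
  rw [← st_add, ENNReal.toReal_sum]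
  · simp only [ENNReal.toReal_mul]
  · exact fun y _ => ENNReal.mul_ne_top (st_ne_top K hsub lam _ _) (st_ne_top K hsub lam _ _)

lemma sr_arw (K : V → V → ℝ≥0∞) (hsub : SubStochastic K) (lam : ℝ) 
    (ν : V → ℝ≥0∞) (hν : IsProbVec ν) (σ : Conf V) (ξ' : V → Bool) :
    ∑ ξ, sr K lam σ ξ * arwMatrix K lam ν ξ ξ' =
      ∑ y, (ν y).toReal * sr K lam (addActiveAt σ y) ξ' := by
  simp only [arw_apply K hsub lam ν hν, ← sr_add K hsub lam σ, Finset.mul_sum]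
  rw [Finset.sum_comm]
  refine Finset.sum_congr rfl fun y _ => Finset.sum_congr rfl fun ξ _ => ?_
  ring

/-- sleeping configuration `η` plus active particles on `A`. -/
def cf (η : V → Bool) (A : Finset V) : Conf V := fun x =>
  if x ∈ A then (if η x then Site.active 1 else Site.active 0) else embed η x

lemma cf_empty (η : V → Bool) : cf η ∅ = embed η := by funext x; simp [cf]

lemma cf_mem (η : V → Bool) {A : Finset V} {y : V} (h : y ∈ A) : ∃ n, cf η A y = Site.active n := by
  unfold cf
  rw [if_pos h]
  split_ifs <;> simp

lemma cf_add (η : V → Bool) {A : Finset V} {y : V} (h : y ∉ A) :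
    addActiveAt (cf η A) y = cf η (insert y A) := by
  funext x
  unfold addActiveAt
  by_cases hx : x = y
  · subst hx
    simp only [Function.update_self]
    simp only [cf, h, if_false, Finset.mem_insert_self, if_true, embed]
    split_ifs <;> rfl
  · rw [Function.update_of_ne hx]
    simp [cf, hx]

/-! positivity and vanishing -/

lemma st_full_pos (K : V → V → ℝ≥0∞) (lam : ℝ) (hlam : 0 < lam) (k : ℕ) :
    ∀ σ : Conf V, (activeSites σ).card = k → (∀ x, σ x = Site.sleeping ∨ σ x = Site.active 0) →
      0 < st K lam σ (fun _ => true) := by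
  induction k with
  | zero =>
    intro σ hc hσ
    have : σ = embed fun _ => true := by
      funext x
      rcases hσ x with h | h
      · simp [h, embed]
      · have : x ∈ activeSites σ := (mem_activeSites _ _).2 ⟨0, h⟩
        rw [Finset.card_eq_zero.1 hc] at this
        simp at this
    rw [this, st_embed]
    simp
  | succ k ih =>
    intro σ hc hσ
    obtain ⟨x, hx⟩ : (activeSites σ).Nonempty := Finset.card_pos.1 (by omega)
    have h0 : σ x = Site.active 0 := by
      rcases hσ x with h | h
      · obtain ⟨n, hn⟩ := (mem_activeSites _ _).1 hx
        rw [h] at hn; cases hn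
      · exact h
    rw [st_top K lam _ hx]
    unfold top
    have hpos : 0 < wt K lam x none * st K lam (act x none σ) (fun _ => true) := by
      refine ENNReal.mul_pos ?_ (ih _ ?_ ?_).ne'
      · simp only [wt]
        exact (ENNReal.div_pos (by simpa using hlam) (by simp)).ne'
      · have : activeSites (act x none σ) = (activeSites σ).erase x := by
          ext v
          rw [Finset.mem_erase, mem_activeSites, mem_activeSites]
          simp only [act, if_pos h0]
          by_cases hv : v = x
          · subst hv; simp
          · simp [hv]
        rw [this, Finset.card_erase_of_mem hx, hc]
        rfl
      · intro v
        simp only [act, if_pos h0]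
        by_cases hv : v = x
        · subst hv; simp
        · simpa [hv] using hσ v
    exact hpos.trans_le (Finset.single_le_sum
      (f := fun i => wt K lam x i * st K lam (act x i σ) (fun _ => true))
      (fun _ _ => zero_le) (Finset.mem_univ none))

def Site.cnt : Site → ℕ
  | .empty => 0
  | .sleeping => 1
  | .active n => n + 1

def cnt (σ : Conf V) : ℕ := ∑ x, (σ x).cnt

lemma cnt_update (σ : Conf V) (x : V) (s : Site) :
    cnt (Function.update σ x s) + (σ x).cnt = cnt σ + s.cnt := by
  unfold cnt
  rw [← Finset.add_sum_erase _ _ (Finset.mem_univ x),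
    ← Finset.add_sum_erase _ (fun v => (σ v).cnt) (Finset.mem_univ x)]
  have : ∑ v ∈ Finset.univ.erase x, (Function.update σ x s v).cnt =
      ∑ v ∈ Finset.univ.erase x, (σ v).cnt := by
    refine Finset.sum_congr rfl fun v hv => ?_
    rw [Function.update_of_ne (Finset.ne_of_mem_erase hv)]
  rw [this]
  simp
  omega

lemma cnt_addActive (s : Site) : s.addActive.cnt = s.cnt + 1 := by cases s <;> rfl

lemma cnt_add (σ : Conf V) (y : V) : cnt (addActiveAt σ y) = cnt σ + 1 := by
  have := cnt_update σ y (σ y).addActive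
  rw [cnt_addActive] at this
  unfold addActiveAt
  omega

lemma cnt_act {σ : Conf V} {x : V} (hx : x ∈ activeSites σ) (i : Option (Option V)) :
    cnt (act x i σ) ≤ cnt σ := by
  obtain ⟨n, hn⟩ := (mem_activeSites _ _).1 hx
  have hd : cnt (act x (some none) σ) + 1 = cnt σ := by
    have := cnt_update σ x (σ x).removeOne
    have h2 : (σ x).removeOne.cnt + 1 = (σ x).cnt := by rw [hn]; cases n <;> rfl
    simp only [act]
    omega
  rcases i with _ | _ | z
  · simp only [act]
    split_ifs with h
    · have := cnt_update σ x Site.sleeping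
      rw [h] at this
      simp only [Site.cnt] at this
      omega
    · exact le_rfl
  · omega
  · change cnt (addActiveAt (act x (some none) σ) z) ≤ _
    rw [cnt_add, hd]

lemma st_full_zero (K : V → V → ℝ≥0∞) (lam : ℝ) (σ : Conf V) (h : cnt σ < Fintype.card V) :
    st K lam σ (fun _ => true) = 0 := by
  unfold st
  simp only [ENNReal.iSup_eq_zero]
  intro n
  induction n generalizing σ with
  | zero =>
    simp only [lz]
    rw [if_neg]
    rintro rfl
    simp [cnt, embed, Site.cnt] at h
  | succ n ih =>
    by_cases ha : (activeSites σ).Nonempty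
    · obtain ⟨x, hx⟩ := ha
      rw [lz_abel K lam _ _ hx]
      exact Finset.sum_eq_zero fun i _ => by
        rw [ih _ ((cnt_act hx i).trans_lt h), mul_zero]
    · obtain ⟨b, rfl⟩ := stable_embed ha
      rw [lz_stable, if_neg]
      rintro rfl
      simp [cnt, embed, Site.cnt] at h

end
end ARW
namespace ARW

section
set_option linter.unusedSectionVars false
variable {V : Type} [Fintype V] [DecidableEq V]

lemma eig_upper (K : V → V → ℝ≥0∞) (hsub : SubStochastic K) (hnd : NonDegenerate K)
    (ν : V → ℝ≥0∞) (hν : IsProbVec ν) (lam : ℝ) (z : ℂ) (hz : z ≠ 1)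
    (hroot : ((arwMatrix K lam ν).map (fun a : ℝ => (a : ℂ))).charpoly.IsRoot z) :
    ∃ x, ‖z‖ ≤ 1 - (hitProb K ν x).toReal := by
  rw [Polynomial.IsRoot, Matrix.eval_charpoly, ← Matrix.exists_mulVec_eq_zero_iff] at hroot
  obtain ⟨f, hf0, hf⟩ := hroot
  have hPf : ∀ η, ∑ ξ, (arwMatrix K lam ν η ξ : ℂ) * f ξ = z * f η := by
    intro η
    have := congrFun hf η
    rw [Matrix.sub_mulVec] at this
    simp only [Pi.sub_apply, Matrix.scalar_apply, Matrix.mulVec_diagonal, Pi.zero_apply,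
      sub_eq_zero] at this
    rw [this]
    simp [Matrix.mulVec, dotProduct]
  obtain ⟨η, hη⟩ := Function.ne_iff.1 hf0
  set h : Conf V → ℂ := fun σ => ∑ ξ, (sr K lam σ ξ : ℂ) * f ξ with hh
  have hstep : ∀ σ, z * h σ = ∑ y, ((ν y).toReal : ℂ) * h (addActiveAt σ y) := by
    intro σ
    simp only [hh, Finset.mul_sum]
    have e1 : ∀ ξ, z * ((sr K lam σ ξ : ℂ) * f ξ) =
        ∑ ξ', ((sr K lam σ ξ * arwMatrix K lam ν ξ ξ' : ℝ) : ℂ) * f ξ' := by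
      intro ξ
      rw [mul_left_comm, ← hPf ξ, Finset.mul_sum]
      refine Finset.sum_congr rfl fun ξ' _ => ?_
      push_cast; ring
    simp only [e1]
    rw [Finset.sum_comm, Finset.sum_comm (s := (Finset.univ : Finset V))]
    refine Finset.sum_congr rfl fun ξ' _ => ?_
    rw [← Finset.sum_mul, ← Complex.ofReal_sum, sr_arw K hsub lam ν hν]
    push_cast
    rw [Finset.sum_mul]
    exact Finset.sum_congr rfl fun y _ => by ring
  have hwalk : ∀ (σ : Conf V) (y : V) (n : ℕ), σ y = Site.active n →
      h (addActiveAt σ y) = ∑ v, ((K y v).toReal : ℂ) * h (addActiveAt σ v) +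
        ((1 - ∑ v, K y v).toReal : ℂ) * h σ := by
    intro σ y n hy
    simp only [hh]
    simp only [sr_walk K hsub lam σ _ y n hy, Complex.ofReal_add, Complex.ofReal_sum,
      Complex.ofReal_mul, add_mul, Finset.sum_add_distrib, Finset.sum_mul, Finset.mul_sum]
    rw [Finset.sum_comm]
    simp only [mul_assoc]
  have hemb : h (cf η ∅) = f η := by
    rw [cf_empty]
    simp [hh, sr, st_embed, apply_ite ENNReal.toReal, apply_ite Complex.ofReal]
  obtain ⟨S, hS, hmax⟩ := Finset.exists_max_image
    (Finset.univ.filter fun S : Finset V => h (cf η S) ≠ 0) Finset.card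
    ⟨∅, by simpa [hemb] using hη⟩
  have hS0 : h (cf η S) ≠ 0 := by simpa using hS
  have hu := solve K hsub hnd S (fun y => h (addActiveAt (cf η S) y)) (h (cf η S)) (by
      intro y hy
      simp only [cf_add η hy]
      by_contra hne
      have := hmax (insert y S) (by simpa using hne)
      rw [Finset.card_insert_of_notMem hy] at this
      omega) (by
      intro y hy
      obtain ⟨n, hn⟩ := cf_mem η hy
      exact hwalk _ y n hn)
  have hzS : z = ((stay K ν S).toReal : ℂ) := by
    have := hstep (cf η S)
    simp only [hu] at this
    rw [stay_toReal K hsub ν hν]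
    apply mul_right_cancel₀ hS0
    rw [this]
    push_cast
    rw [Finset.sum_mul]
    exact Finset.sum_congr rfl fun y _ => by ring
  have hSne : S ≠ Finset.univ := by
    rintro rfl
    apply hz
    rw [hzS]
    have : stay K ν Finset.univ = 1 := by
      unfold stay
      simp only [av_univ K hsub hnd, mul_one]
      exact hν
    simp [this]
  obtain ⟨x, hx⟩ : ∃ x, x ∉ S := by
    by_contra hcon
    push Not at hcon
    exact hSne (Finset.eq_univ_iff_forall.2 hcon)
  refine ⟨x, ?_⟩
  rw [← stay_erase K hsub hnd ν hν x, hzS, Complex.norm_real,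
    Real.norm_of_nonneg ENNReal.toReal_nonneg]
  refine ENNReal.toReal_mono ?_ (stay_mono K ν ?_)
  · exact ((le_add_self.trans (hit_add_stay K hsub hnd ν hν x).le).trans_lt (by simp)).ne
  · intro v hv
    simp only [Finset.mem_erase, Finset.mem_univ, and_true]
    rintro rfl
    exact hx hv

lemma eig_lower (K : V → V → ℝ≥0∞) (hsub : SubStochastic K) (hnd : NonDegenerate K)
    (ν : V → ℝ≥0∞) (hν : IsProbVec ν) (lam : ℝ) (hlam : 0 < lam) (x : V) :
    ((arwMatrix K lam ν).map (fun a : ℝ => (a : ℂ))).charpoly.IsRoot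
      ((1 - (hitProb K ν x).toReal : ℝ) : ℂ) := by
  rw [Polynomial.IsRoot, Matrix.eval_charpoly, ← Matrix.exists_vecMul_eq_zero_iff]
  set o : V → Bool := fun _ => false with ho
  set A := cf o (Finset.univ.erase x) with hA
  set B := cf o Finset.univ with hB
  have hAx : addActiveAt A x = B := by
    rw [hA, cf_add o (by simp), Finset.insert_erase (Finset.mem_univ x)]
  have hBw : ∀ ξ y, sr K lam (addActiveAt B y) ξ = sr K lam B ξ := by
    intro ξ y
    have := solve K hsub hnd Finset.univ (fun y => (sr K lam (addActiveAt B y) ξ : ℂ))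
      (sr K lam B ξ : ℂ) (by simp) (by
        intro y hy
        obtain ⟨n, hn⟩ := cf_mem o hy
        simp only [sr_walk K hsub lam B ξ y n hn]
        push_cast
        rfl) y
    rw [av_univ K hsub hnd] at this
    simp at this
    exact_mod_cast this
  have hAw : ∀ ξ y, sr K lam (addActiveAt A y) ξ - sr K lam B ξ =
      (sr K lam A ξ - sr K lam B ξ) * (av K (Finset.univ.erase x) y).toReal := by
    intro ξ y
    have := solve K hsub hnd (Finset.univ.erase x)
      (fun y => ((sr K lam (addActiveAt A y) ξ - sr K lam B ξ : ℝ) : ℂ))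
      ((sr K lam A ξ - sr K lam B ξ : ℝ) : ℂ) (by
        intro y hy
        have : y = x := by simpa using hy
        subst this
        simp [hAx]) (by
        intro y hy
        obtain ⟨n, hn⟩ := cf_mem o hy
        have e : sr K lam (addActiveAt A y) ξ - sr K lam B ξ =
            ∑ z, (K y z).toReal * (sr K lam (addActiveAt A z) ξ - sr K lam B ξ) +
            (1 - ∑ z, K y z).toReal * (sr K lam A ξ - sr K lam B ξ) := by
          rw [sr_walk K hsub lam A ξ y n hn, kap_eq K hsub]
          simp only [mul_sub, Finset.sum_sub_distrib, ← Finset.sum_mul]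
          ring
        simp only [e]
        push_cast
        rfl) y
    exact_mod_cast this
  refine ⟨fun ξ => ((sr K lam A ξ - sr K lam B ξ : ℝ) : ℂ), ?_, ?_⟩
  · intro h0
    have h1 := congrFun h0 (fun _ => true)
    have hAz : sr K lam A (fun _ => true) = 0 := by
      unfold sr
      rw [st_full_zero]
      · simp
      · have h2 : cnt A + 1 = cnt B := by rw [← hAx, cnt_add]
        have h3 : cnt B = Fintype.card V := by simp [hB, cnt, cf, ho, Site.cnt]
        omega
    have hBp : 0 < sr K lam B (fun _ => true) := by
      unfold sr
      refine ENNReal.toReal_pos (st_full_pos K lam hlam _ B rfl ?_).ne' (st_ne_top K hsub lam _ _)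
      intro v
      right
      simp [hB, cf, ho]
    rw [hAz] at h1
    have h2 : (0 - sr K lam B (fun _ => true)) = 0 := Complex.ofReal_eq_zero.1 h1
    linarith
  · funext ξ'
    rw [Matrix.vecMul_sub]
    simp only [Pi.sub_apply, Matrix.scalar_apply, Matrix.vecMul_diagonal, Pi.zero_apply,
      sub_eq_zero]
    simp only [Matrix.vecMul, dotProduct, Matrix.map_apply]
    rw [← stay_erase K hsub hnd ν hν x]
    norm_cast
    simp only [sub_mul, Finset.sum_sub_distrib]
    rw [sr_arw K hsub lam ν hν, sr_arw K hsub lam ν hν, ← Finset.sum_sub_distrib, ← sub_mul,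
      stay_toReal K hsub ν hν, Finset.mul_sum]
    refine Finset.sum_congr rfl fun y _ => ?_
    rw [hBw, ← mul_sub, hAw]
    ring

end
end ARW
namespace ARW

/-- **Theorem 1 (Relaxation time).**  For any finite non-degenerate network `(V,K)`,
any sleeping rate `lam ∈ (0,∞)` and any admissible insertion law `ν`, the relaxation
time of the `ARW(K,lam,ν)` chain is exactly `(min_{x∈V} p(x))⁻¹`. -/
theorem arw_relaxation_time
    {V : Type} [Fintype V] [DecidableEq V] [Nonempty V]
    (K : V → V → ℝ≥0∞) (hsub : SubStochastic K) (hnd : NonDegenerate K)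
    (ν : V → ℝ≥0∞) (hν : IsProbVec ν) (hadm : Admissible K ν)
    (lam : ℝ) (hlam : 0 < lam) :
    relTime (arwMatrix K lam ν) = ((⨅ x, hitProb K ν x).toReal)⁻¹ := by
  obtain ⟨x0, hx0⟩ := Finite.exists_min fun x => hitProb K ν x
  have hinf : (⨅ x, hitProb K ν x) = hitProb K ν x0 :=
    le_antisymm (iInf_le _ x0) (le_iInf hx0)
  have hft : ∀ x, hitProb K ν x ≠ ⊤ := fun x =>
    ((hit_le_one K hsub hnd ν hν x).trans_lt (by simp)).ne
  rw [hinf]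
  unfold relTime
  have hg : IsGreatest {r : ℝ | ∃ z : ℂ, z ≠ 1 ∧
      ((arwMatrix K lam ν).map (fun a : ℝ => (a : ℂ))).charpoly.IsRoot z ∧ r = ‖z‖}
      (1 - (hitProb K ν x0).toReal) := by
    constructor
    · refine ⟨((1 - (hitProb K ν x0).toReal : ℝ) : ℂ), ?_,
        eig_lower K hsub hnd ν hν lam hlam x0, ?_⟩
      · intro h
        have h1 : (1 - (hitProb K ν x0).toReal : ℝ) = 1 := by exact_mod_cast h
        have h2 := ENNReal.toReal_pos (hadm x0).ne' (hft x0)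
        linarith
      · rw [Complex.norm_real, Real.norm_of_nonneg]
        rw [← stay_erase K hsub hnd ν hν x0]
        exact ENNReal.toReal_nonneg
    · rintro r ⟨z, hz1, hz, rfl⟩
      obtain ⟨x, hx⟩ := eig_upper K hsub hnd ν hν lam z hz1 hz
      have := ENNReal.toReal_mono (hft x) (hx0 x)
      linarith
  rw [hg.csSup_eq]
  simp

end ARW
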